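/- arXiv:1704.04405 — 2 statements merged into one kernel-verified Lean document; each statement's English description precedes it below -/
import Mathlib

section
/- (Modified Cauchy–Binet formula.) Let m, N ≥ 1, let u, v be m × N matrices over a commutative ring, let S and B be disjoint strictly increasing tuples of column indices in {1,…,N} with |S| ≤ m and |B| ≥ m − |S|. Then Σ_{β ⊆ B, |β| = m − |S|} det(u_{[m], β∪S}) · det(v_{[m], β∪S}) = (−1)^{|S|} det( [[ 0_{|S|×|S|}, v^T_{S [m]} ], [ u_{[m] S}, u_{[m] B} v^T_{B [m]} ]] ), where the sum is over strictly increasing tuples β of entries of B, β∪S denotes the strictly increasing tuple of all indices in β or S, and the right-hand side is the determinant of the indicated (m+|S|) × (m+|S|) block matrix. -/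
open Matrix

noncomputable section

/-- The maximal minor of `u` on the columns in `γ`, and `0` if `γ` has the wrong cardinality. -/
def maxMinor {R : Type*} [CommRing R] {m N : ℕ} (u : Matrix (Fin m) (Fin N) R)
    (γ : Finset (Fin N)) : R :=
  if h : γ.card = m then (u.submatrix id (γ.orderEmbOfFin h)).det else 0

lemma maxMinor_of_card {R : Type*} [CommRing R] {m N : ℕ} (u : Matrix (Fin m) (Fin N) R)
    {γ : Finset (Fin N)} (h : γ.card = m) :
    maxMinor u γ = (u.submatrix id (γ.orderEmbOfFin h)).det :=
  dif_pos h

lemma det_mul_transpose_eq_sum_functions {R : Type*} [CommRing R] {m N : ℕ}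
    (u v : Matrix (Fin m) (Fin N) R) :
    (u * vᵀ).det = ∑ f : Fin m → Fin N, (∏ i, v i (f i)) * (u.submatrix id f).det := by
  rw [← det_transpose]
  have h : (u * vᵀ)ᵀ = fun i => ∑ k, v i k • uᵀ k := by
    ext i j
    simp [Matrix.mul_apply, Finset.sum_apply, mul_comm]
  change detRowAlternating.toMultilinearMap _ = _
  rw [h, MultilinearMap.map_sum]
  refine Finset.sum_congr rfl fun f _ => ?_
  rw [MultilinearMap.map_smul_univ, smul_eq_mul, ← det_transpose (u.submatrix id f)]
  rfl

lemma sum_injective_image_eq {R : Type*} [CommRing R] {m N : ℕ}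
    (u v : Matrix (Fin m) (Fin N) R) {γ : Finset (Fin N)} (h : γ.card = m) :
    ∑ f : Fin m → Fin N with Function.Injective f ∧ Finset.univ.image f = γ,
      (∏ i, v i (f i)) * (u.submatrix id f).det = maxMinor u γ * maxMinor v γ := by
  rw [maxMinor_of_card u h, maxMinor_of_card v h,
    ← det_transpose (v.submatrix _ _), det_apply' (v.submatrix _ _)ᵀ,
    Finset.mul_sum]
  symm
  refine Finset.sum_bij (fun (σ : Equiv.Perm (Fin m)) _ => γ.orderEmbOfFin h ∘ σ) ?_ ?_ ?_ ?_
  · intro σ _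
    simp only [Finset.mem_filter, Finset.mem_univ, true_and]
    refine ⟨(γ.orderEmbOfFin h).injective.comp σ.injective, ?_⟩
    apply Finset.coe_injective
    rw [Finset.coe_image, Finset.coe_univ, Set.image_univ, σ.surjective.range_comp,
      Finset.range_orderEmbOfFin]
  · intro σ _ τ _ hστ
    ext1 i
    exact (γ.orderEmbOfFin h).injective (congrFun hστ i)
  · intro f hf
    simp only [Finset.mem_filter, Finset.mem_univ, true_and] at hf
    obtain ⟨hinj, him⟩ := hf
    have hmem : ∀ i, ∃ j, γ.orderEmbOfFin h j = f i := fun i => by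
      have : f i ∈ Set.range (γ.orderEmbOfFin h) := by
        rw [Finset.range_orderEmbOfFin, ← him]
        simp
      exact this
    choose g hg using hmem
    have hginj : Function.Injective g := fun i j hij => hinj (by rw [← hg i, ← hg j, hij])
    refine ⟨Equiv.ofBijective g (Finite.injective_iff_bijective.mp hginj), Finset.mem_univ _, ?_⟩
    funext i
    exact hg i
  · intro σ _
    have hu : (u.submatrix id (γ.orderEmbOfFin h ∘ σ)).det =
        Equiv.Perm.sign σ * (u.submatrix id (γ.orderEmbOfFin h)).det := by
      rw [← det_permute']
      rfl
    rw [hu]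
    simp only [transpose_apply, submatrix_apply, id_eq, Function.comp_apply]
    ring

/-- The Cauchy–Binet formula. -/
lemma det_mul_transpose_eq_sum_maxMinor {R : Type*} [CommRing R] {m N : ℕ}
    (u v : Matrix (Fin m) (Fin N) R) :
    (u * vᵀ).det =
      ∑ γ ∈ Finset.univ.powersetCard m, maxMinor u γ * maxMinor v γ := by
  rw [det_mul_transpose_eq_sum_functions,
    ← Finset.sum_filter_of_ne (p := Function.Injective),
    ← Finset.sum_fiberwise_of_maps_to (g := fun f => Finset.univ.image f)
      (t := Finset.univ.powersetCard m)]
  · refine Finset.sum_congr rfl fun γ hγ => ?_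
    rw [Finset.filter_filter]
    exact sum_injective_image_eq u v (Finset.mem_powersetCard.mp hγ).2
  · intro f hf
    have hf' : Function.Injective f := (Finset.mem_filter.mp hf).2
    simp [Finset.mem_powersetCard, Finset.card_image_of_injective _ hf']
  · intro f _ hf
    by_contra hinj
    simp only [Function.Injective, not_forall] at hinj
    obtain ⟨i, j, hij, hne⟩ := hinj
    exact hf (by rw [det_zero_of_column_eq hne (by simp [hij]), mul_zero])

lemma maxMinor_mul_diagonal {R : Type*} [CommRing R] {m N : ℕ}
    (u : Matrix (Fin m) (Fin N) R) (d : Fin N → R) (γ : Finset (Fin N)) :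
    maxMinor (u * diagonal d) γ = (∏ i ∈ γ, d i) * maxMinor u γ := by
  by_cases h : γ.card = m
  · rw [maxMinor_of_card _ h, maxMinor_of_card _ h]
    have hp : ∏ i ∈ γ, d i = ∏ i, d (γ.orderEmbOfFin h i) := by
      conv_lhs => rw [← Finset.map_orderEmbOfFin_univ γ h, Finset.prod_map]
      rfl
    rw [hp, ← det_mul_row]
    congr 1
    ext i j
    simp [mul_diagonal, mul_comm]
  · simp [maxMinor, h]

lemma maxMinor_map {R T : Type*} [CommRing R] [CommRing T] (f : R →+* T) {m N : ℕ}
    (u : Matrix (Fin m) (Fin N) R) (γ : Finset (Fin N)) :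
    maxMinor (u.map f) γ = f (maxMinor u γ) := by
  unfold maxMinor
  split_ifs with h
  · rw [RingHom.map_det]
    rfl
  · simp

open Polynomial in
/-- Weights `1` on `S`, `X` on `B` and `0` elsewhere. -/
def columnWeight (R : Type*) [CommRing R] {N : ℕ} (S B : Finset (Fin N)) (i : Fin N) : R[X] :=
  if i ∈ S then 1 else if i ∈ B then X else 0

lemma prod_columnWeight {R : Type*} [CommRing R] {N : ℕ} {S B γ : Finset (Fin N)}
    (hγ : γ ⊆ S ∪ B) :
    ∏ i ∈ γ, columnWeight R S B i = Polynomial.X ^ (γ \ S).card := by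
  rw [← Finset.prod_sdiff (Finset.inter_subset_left : γ ∩ S ⊆ γ), Finset.sdiff_inter_self_left]
  rw [Finset.prod_congr (s₁ := γ ∩ S) (g := fun _ => 1) rfl, Finset.prod_const_one, mul_one,
    Finset.prod_congr (s₁ := γ \ S) (g := fun _ => Polynomial.X) rfl, Finset.prod_const]
  · intro i hi
    obtain ⟨h1, h2⟩ := Finset.mem_sdiff.mp hi
    have h3 : i ∈ B := (Finset.mem_union.mp (hγ h1)).resolve_left h2
    simp [columnWeight, h2, h3]
  · intro i hi
    simp [columnWeight, (Finset.mem_inter.mp hi).2]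

lemma coeff_prod_columnWeight {R : Type*} [CommRing R] {m N : ℕ} {S B γ : Finset (Fin N)}
    (hS : S.card ≤ m) (hγ : γ.card = m) :
    (∏ i ∈ γ, columnWeight R S B i).coeff (m - S.card) =
      if S ⊆ γ ∧ γ ⊆ S ∪ B then 1 else 0 := by
  by_cases h : γ ⊆ S ∪ B
  · rw [prod_columnWeight h, Polynomial.coeff_X_pow]
    have key : m - S.card = (γ \ S).card ↔ S ⊆ γ := by
      have h1 := Finset.card_sdiff_add_card_inter γ S
      have h2 : (γ ∩ S).card = S.card ↔ S ⊆ γ := by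
        rw [← Finset.inter_eq_right]
        exact ⟨fun h => Finset.eq_of_subset_of_card_le Finset.inter_subset_right h.ge,
          fun h => by rw [h]⟩
      rw [← h2]
      omega
    simp [key, h]
  · obtain ⟨i, hi, hni⟩ := Finset.not_subset.mp h
    rw [Finset.mem_union, not_or] at hni
    rw [Finset.prod_eq_zero hi (by simp [columnWeight, hni.1, hni.2])]
    simp [h]

lemma coeff_det_columnWeight {R : Type*} [CommRing R] {m N : ℕ}
    (u v : Matrix (Fin m) (Fin N) R) {S B : Finset (Fin N)} (hSB : Disjoint S B)
    (hS : S.card ≤ m) :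
    (u.map Polynomial.C * diagonal (columnWeight R S B) *
      (v.map Polynomial.C)ᵀ).det.coeff (m - S.card) =
      ∑ β ∈ B.powersetCard (m - S.card), maxMinor u (β ∪ S) * maxMinor v (β ∪ S) := by
  rw [det_mul_transpose_eq_sum_maxMinor, Polynomial.finsetSum_coeff]
  simp only [maxMinor_mul_diagonal, maxMinor_map]
  have h : ∀ γ ∈ (Finset.univ : Finset (Fin N)).powersetCard m,
      ((∏ i ∈ γ, columnWeight R S B i) * Polynomial.C (maxMinor u γ) *
        Polynomial.C (maxMinor v γ)).coeff (m - S.card) =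
      if S ⊆ γ ∧ γ ⊆ S ∪ B then maxMinor u γ * maxMinor v γ else 0 := by
    intro γ hγ
    rw [Polynomial.coeff_mul_C, Polynomial.coeff_mul_C,
      coeff_prod_columnWeight hS (Finset.mem_powersetCard.mp hγ).2]
    split_ifs <;> simp
  rw [Finset.sum_congr rfl h, ← Finset.sum_filter]
  symm
  refine Finset.sum_bij' (fun β _ => β ∪ S) (fun γ _ => γ \ S) ?_ ?_ ?_ ?_ ?_
  · intro β hβ
    obtain ⟨h1, h2⟩ := Finset.mem_powersetCard.mp hβ
    simp only [Finset.mem_filter, Finset.mem_powersetCard, Finset.subset_univ, true_and]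
    refine ⟨?_, Finset.subset_union_right, ?_⟩
    · rw [Finset.card_union_of_disjoint (hSB.symm.mono_left h1)]
      omega
    · rw [Finset.union_comm]
      exact Finset.union_subset_union_right h1
  · intro γ hγ
    simp only [Finset.mem_filter, Finset.mem_powersetCard, Finset.subset_univ, true_and] at hγ ⊢
    obtain ⟨h1, h2, h3⟩ := hγ
    refine ⟨sdiff_le_iff.mpr h3, ?_⟩
    rw [Finset.card_sdiff_of_subset h2, h1]
  · intro β hβ
    obtain ⟨h1, h2⟩ := Finset.mem_powersetCard.mp hβ
    exact Finset.union_sdiff_cancel_right (hSB.symm.mono_left h1)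
  · intro γ hγ
    exact Finset.sdiff_union_of_subset (Finset.mem_filter.mp hγ).2.1
  · intros
    rfl

lemma submatrix_orderEmbOfFin_mul_apply {R : Type*} [CommRing R] {m N : ℕ}
    (u v : Matrix (Fin m) (Fin N) R) (S : Finset (Fin N)) (i j : Fin m) :
    (u.submatrix id (S.orderEmbOfFin rfl) * vᵀ.submatrix (S.orderEmbOfFin rfl) id) i j =
      ∑ k ∈ S, u i k * v j k := by
  conv_rhs => rw [← Finset.map_orderEmbOfFin_univ S rfl, Finset.sum_map]
  rfl

lemma mul_diagonal_columnWeight_mul {R : Type*} [CommRing R] {m N : ℕ}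
    (u v : Matrix (Fin m) (Fin N) R) {S B : Finset (Fin N)} (hSB : Disjoint S B) :
    u.map Polynomial.C * diagonal (columnWeight R S B) * (v.map Polynomial.C)ᵀ =
      (u.submatrix id (S.orderEmbOfFin rfl) *
        vᵀ.submatrix (S.orderEmbOfFin rfl) id).map Polynomial.C +
      (Polynomial.X : Polynomial R) • (u.submatrix id (B.orderEmbOfFin rfl) *
        vᵀ.submatrix (B.orderEmbOfFin rfl) id).map Polynomial.C := by
  ext1 i j
  rw [Matrix.add_apply, Matrix.smul_apply, Matrix.map_apply, Matrix.map_apply,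
    submatrix_orderEmbOfFin_mul_apply, submatrix_orderEmbOfFin_mul_apply, Matrix.mul_apply]
  simp only [mul_diagonal, Matrix.map_apply, transpose_apply, map_sum, map_mul, smul_eq_mul,
    Finset.mul_sum]
  rw [← Finset.sum_subset (Finset.subset_univ (S ∪ B)), Finset.sum_union hSB]
  · congr 1
    · refine Finset.sum_congr rfl fun k hk => ?_
      simp [columnWeight, hk]
    · refine Finset.sum_congr rfl fun k hk => ?_
      simp only [columnWeight, Finset.disjoint_right.mp hSB hk, hk, if_true, if_false]
      ring
  · intro k _ hk
    rw [Finset.mem_union, not_or] at hk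
    simp [columnWeight, hk.1, hk.2]

lemma det_fromBlocks_zero_neg {R : Type*} [CommRing R] {s m : ℕ}
    (U : Matrix (Fin m) (Fin s) R) (V : Matrix (Fin s) (Fin m) R) (M : Matrix (Fin m) (Fin m) R) :
    (fromBlocks 0 (-V) U M).det = (-1) ^ s * (fromBlocks 0 V U M).det := by
  have h : fromBlocks 0 (-V) U M =
      fromBlocks (-1 : Matrix (Fin s) (Fin s) R) 0 0 1 * fromBlocks 0 V U M := by
    simp [fromBlocks_multiply]
  rw [h, det_mul, det_fromBlocks_zero₂₁]
  simp [det_neg]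

lemma coeff_det_add_X_smul {R : Type*} [CommRing R] {s m : ℕ} (hs : s ≤ m)
    (U : Matrix (Fin m) (Fin s) R) (V : Matrix (Fin s) (Fin m) R) (M : Matrix (Fin m) (Fin m) R) :
    ((U * V).map Polynomial.C + (Polynomial.X : Polynomial R) • M.map Polynomial.C).det.coeff
      (m - s) = (-1) ^ s * (fromBlocks 0 V U M).det := by
  set x : Polynomial R := Polynomial.X with hx
  set U' := U.map (Polynomial.C : R →+* Polynomial R) with hU
  set V' := V.map (Polynomial.C : R →+* Polynomial R) with hV
  set M' := M.map (Polynomial.C : R →+* Polynomial R) with hM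
  have hF : ((U * V).map Polynomial.C + x • M').det = (fromBlocks 1 (-V') U' (x • M')).det := by
    rw [det_fromBlocks_one₁₁, Matrix.map_mul, Matrix.mul_neg, sub_neg_eq_add, add_comm]
  have hscale : fromBlocks (x • (1 : Matrix (Fin s) (Fin s) (Polynomial R))) 0 0 1 *
      fromBlocks 1 (-V') U' (x • M') =
      fromBlocks (x • 1) (-V') U' M' * fromBlocks 1 0 0 (x • 1) := by
    simp [fromBlocks_multiply]
  have hdet := congrArg det hscale
  rw [det_mul, det_mul, det_fromBlocks_zero₂₁, det_fromBlocks_zero₂₁, ← hF] at hdet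
  simp only [det_smul, det_one, mul_one, one_mul, Fintype.card_fin] at hdet
  have hc := congrArg (fun p => Polynomial.coeff p m) hdet
  simp only [hx] at hc
  rw [mul_comm (fromBlocks _ _ _ _).det, Polynomial.coeff_X_pow_mul', Polynomial.coeff_X_pow_mul',
    if_pos hs, if_pos le_rfl, Nat.sub_self, Polynomial.coeff_zero_eq_eval_zero] at hc
  rw [hc, ← det_fromBlocks_zero_neg, ← Polynomial.coe_evalRingHom, RingHom.map_det]
  congr 1
  ext (i | i) (j | j) <;> simp [hU, hV, hM]

/-- modified Cauchy–Binet formula.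
For `m × N` matrices `u, v` over a commutative ring, disjoint increasing index tuples
(`Finset`s) `S` and `B` of columns with `|S| ≤ m` and `|B| ≥ m − |S|`,
`Σ_{β ⊆ B, |β| = m−|S|} det(u_{[m],β∪S}) det(v_{[m],β∪S})
  = (−1)^{|S|} det [[0, vᵀ_{S[m]}],[u_{[m]S}, u_{[m]B} vᵀ_{B[m]}]]`. -/
theorem statement9 {R : Type*} [CommRing R] (m N : ℕ) (hm : 1 ≤ m) (hN : 1 ≤ N)
    (u v : Matrix (Fin m) (Fin N) R) (S B : Finset (Fin N)) (hSB : Disjoint S B)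
    (hS : S.card ≤ m) (hB : m - S.card ≤ B.card) :
    ∑ β ∈ (B.powersetCard (m - S.card)).attach,
        (u.submatrix id ⇑((β.1 ∪ S).orderEmbOfFin
            (by
              have h := Finset.mem_powersetCard.mp β.2
              rw [Finset.card_union_of_disjoint (hSB.symm.mono_left h.1)]
              omega))).det *
        (v.submatrix id ⇑((β.1 ∪ S).orderEmbOfFin
            (by
              have h := Finset.mem_powersetCard.mp β.2
              rw [Finset.card_union_of_disjoint (hSB.symm.mono_left h.1)]
              omega))).det =
      (-1 : R) ^ S.card *
        (Matrix.fromBlocks (0 : Matrix (Fin S.card) (Fin S.card) R)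
          (vᵀ.submatrix ⇑(S.orderEmbOfFin rfl) id)
          (u.submatrix id ⇑(S.orderEmbOfFin rfl))
          (u.submatrix id ⇑(B.orderEmbOfFin rfl) *
            vᵀ.submatrix ⇑(B.orderEmbOfFin rfl) id)).det := by
  have hLHS := coeff_det_columnWeight u v hSB hS
  rw [mul_diagonal_columnWeight_mul u v hSB, coeff_det_add_X_smul hS] at hLHS
  rw [hLHS, ← Finset.sum_attach _ fun β => maxMinor u (β ∪ S) * maxMinor v (β ∪ S)]
  refine Finset.sum_congr rfl fun β _ => ?_
  have h := Finset.mem_powersetCard.mp β.2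
  have hcard : (β.1 ∪ S).card = m := by
    rw [Finset.card_union_of_disjoint (hSB.symm.mono_left h.1)]
    omega
  rw [maxMinor_of_card u hcard, maxMinor_of_card v hcard]

end
end

section
/- (Fixed-parity Cauchy–Binet sum.) Let m, N ≥ 1, let u, v be m × N matrices over ℂ, let S, B_l, B_r be pairwise disjoint strictly increasing tuples of column indices in {1,…,N} with |S| ≤ m, set B = B_l ∪ B_r, and fix p ∈ {0,1}. Then Σ det(u_{[m], (β_l, S, β_r)}) det(v_{[m], (β_l, S, β_r)}), the sum over strictly increasing tuples β_l ⊆ B_l and β_r ⊆ B_r with |β_l| + |β_r| = m − |S| and |β_r| ≡ p (mod 2), and with columns taken in the concatenated order (β_l, S, β_r), equals ((−1)^{|S|}/2) · [ det( [[0_{|S|×|S|}, v^T_{S [m]}], [u_{[m] S}, u_{[m] B} v^T_{B [m]}]] ) + (−1)^p det( [[0_{|S|×|S|}, v^T_{S [m]}], [u_{[m] S}, u_{[m] B} (I − 2P_{B_r})_{BB} v^T_{B [m]}]] ) ]. -/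
open Matrix

noncomputable section

namespace Matrix

open Finset Equiv

/-- The product of the maximal minors of `u` and `v` on the columns indexed by `γ`,
or `0` if `γ` does not have as many elements as there are rows. -/
def minorProd {R : Type*} [CommRing R] {m N : ℕ} (u v : Matrix (Fin m) (Fin N) R)
    (γ : Finset (Fin N)) : R :=
  if h : γ.card = m then
    (u.submatrix id (γ.orderEmbOfFin h)).det * (v.submatrix id (γ.orderEmbOfFin h)).det
  else 0

variable {R : Type*} [CommRing R] {m N : ℕ}

theorem exists_perm_orderEmbOfFin_comp {f : Fin m → Fin N} (hf : Function.Injective f)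
    {γ : Finset (Fin N)} (hγ : univ.image f = γ) (h : γ.card = m) :
    ∃ σ : Perm (Fin m), f = γ.orderEmbOfFin h ∘ σ := by
  have hmem : ∀ i, ∃ j, γ.orderEmbOfFin h j = f i := fun i => by
    have : f i ∈ Set.range (γ.orderEmbOfFin h) := by
      rw [range_orderEmbOfFin, ← hγ]
      simp
    exact this
  choose g hg using hmem
  have hinj : Function.Injective g := fun a b hab => hf (by rw [← hg, ← hg, hab])
  exact ⟨Equiv.ofBijective g (Finite.injective_iff_bijective.mp hinj), funext fun i => (hg i).symm⟩

theorem minorProd_eq_of_image_eq (u v : Matrix (Fin m) (Fin N) R) {f : Fin m → Fin N}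
    (hf : Function.Injective f) {γ : Finset (Fin N)} (hγ : univ.image f = γ) :
    (u.submatrix id f).det * (v.submatrix id f).det = minorProd u v γ := by
  have h : γ.card = m := by rw [← hγ, card_image_of_injective _ hf, card_univ, Fintype.card_fin]
  obtain ⟨σ, rfl⟩ := exists_perm_orderEmbOfFin_comp hf hγ h
  have key : ∀ w : Matrix (Fin m) (Fin N) R,
      (w.submatrix id (γ.orderEmbOfFin h ∘ σ)).det =
        Perm.sign σ * (w.submatrix id (γ.orderEmbOfFin h)).det := fun w =>
    det_permute' σ (w.submatrix id (γ.orderEmbOfFin h))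
  have hs : ((Perm.sign σ : ℤ) : R) * ((Perm.sign σ : ℤ) : R) = 1 := by
    rw [← Int.cast_mul, ← Units.val_mul, Int.units_mul_self]
    simp
  rw [minorProd, dif_pos h, key, key, mul_mul_mul_comm, hs, one_mul]

theorem mul_diagonal_mul_transpose_apply {ι κ : Type*} [Fintype κ] [DecidableEq κ]
    (u v : Matrix ι κ R) (d : κ → R) (a b : ι) :
    (u * diagonal d * vᵀ) a b = ∑ j, u a j * d j * v b j := by
  rw [mul_apply]
  simp only [mul_diagonal, transpose_apply]

theorem det_mul_diagonal_mul_transpose_eq_sum_fun (u v : Matrix (Fin m) (Fin N) R)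
    (d : Fin N → R) :
    (u * diagonal d * vᵀ).det =
      ∑ f : Fin m → Fin N, (∏ i, d (f i)) * ((∏ i, u i (f i)) * (v.submatrix id f).det) := by
  rw [← det_transpose]
  simp only [det_apply', transpose_apply, mul_diagonal_mul_transpose_apply,
    prod_univ_sum, mul_sum, Fintype.piFinset_univ, submatrix_apply, id_eq]
  rw [Finset.sum_comm]
  refine sum_congr rfl fun f _ => sum_congr rfl fun σ _ => ?_
  simp only [prod_mul_distrib]
  ring

/-- The weighted **Cauchy–Binet formula**. -/
theorem det_mul_diagonal_mul_transpose (u v : Matrix (Fin m) (Fin N) R) (d : Fin N → R) :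
    (u * diagonal d * vᵀ).det = ∑ γ : Finset (Fin N), (∏ j ∈ γ, d j) * minorProd u v γ := by
  rw [det_mul_diagonal_mul_transpose_eq_sum_fun,
    ← sum_fiberwise univ (fun f : Fin m → Fin N => univ.image f)]
  refine sum_congr rfl fun γ _ => ?_
  by_cases h : γ.card = m
  · set e := γ.orderEmbOfFin h
    rw [minorProd, dif_pos h, ← det_transpose (u.submatrix id _), det_apply', sum_mul, mul_sum]
    have himage : ∀ σ : Perm (Fin m), univ.image (e ∘ σ) = γ := fun σ => by
      rw [← image_image, image_univ_equiv, image_orderEmbOfFin_univ]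
    symm
    refine sum_bij (fun σ _ => e ∘ σ) (fun σ _ => ?_) (fun σ _ τ _ hστ => ?_) (fun f hf => ?_)
      fun σ _ => ?_
    · exact mem_filter.mpr ⟨mem_univ _, himage σ⟩
    · exact Equiv.ext fun i => e.injective (congrFun hστ i)
    · have hfγ := (mem_filter.mp hf).2
      have hinj : Function.Injective f := by
        rw [← Set.injOn_univ, ← coe_univ, ← card_image_iff, hfγ, h, card_univ, Fintype.card_fin]
      obtain ⟨σ, hσ⟩ := exists_perm_orderEmbOfFin_comp hinj hfγ h
      exact ⟨σ, mem_univ _, hσ.symm⟩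
    · have hprod : ∏ i, d ((e ∘ σ) i) = ∏ j ∈ γ, d j := by
        rw [← himage σ, prod_image (e.injective.comp σ.injective).injOn]
      have hdet : (v.submatrix id (e ∘ σ)).det = Perm.sign σ * (v.submatrix id e).det :=
        det_permute' σ (v.submatrix id e)
      rw [hprod, hdet]
      simp only [transpose_apply, submatrix_apply, id_eq, Function.comp_apply]
      ring
  · rw [minorProd, dif_neg h, mul_zero]
    refine sum_eq_zero fun f hf => ?_
    have hni : ¬ Function.Injective f := fun hf' => h (by
      rw [← (mem_filter.mp hf).2, card_image_of_injective _ hf', card_univ, Fintype.card_fin])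
    simp only [Function.Injective, not_forall] at hni
    obtain ⟨i, j, hij, hne⟩ := hni
    rw [det_zero_of_column_eq hne fun k => by simp [hij], mul_zero, mul_zero]

theorem submatrix_mul_diagonal_mul_submatrix_transpose (u v : Matrix (Fin m) (Fin N) R)
    (B : Finset (Fin N)) (d : Fin N → R) :
    u.submatrix id (B.orderEmbOfFin rfl) *
        (diagonal d).submatrix (B.orderEmbOfFin rfl) (B.orderEmbOfFin rfl) *
        vᵀ.submatrix (B.orderEmbOfFin rfl) id =
      u * diagonal (fun j => if j ∈ B then d j else 0) * vᵀ := by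
  ext a b
  rw [submatrix_diagonal _ _ (B.orderEmbOfFin rfl).injective, mul_diagonal_mul_transpose_apply]
  refine (mul_diagonal_mul_transpose_apply (u.submatrix id (B.orderEmbOfFin rfl))
    (v.submatrix id (B.orderEmbOfFin rfl)) _ a b).trans ?_
  simp only [mul_ite, mul_zero, ite_mul, zero_mul, sum_ite_mem, univ_inter]
  conv_rhs => rw [← map_orderEmbOfFin_univ B rfl, sum_map]
  rfl

theorem submatrix_mul_submatrix_transpose (u v : Matrix (Fin m) (Fin N) R)
    (B : Finset (Fin N)) :
    u.submatrix id (B.orderEmbOfFin rfl) * vᵀ.submatrix (B.orderEmbOfFin rfl) id =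
      u * diagonal (fun j => if j ∈ B then (1 : R) else 0) * vᵀ := by
  rw [← submatrix_mul_diagonal_mul_submatrix_transpose u v B fun _ => 1, diagonal_one,
    submatrix_one _ (B.orderEmbOfFin rfl).injective, Matrix.mul_one]

theorem det_fromBlocks_neg_smul_one {K : Type*} [Field K] (u v : Matrix (Fin m) (Fin N) K)
    (S : Finset (Fin N)) (w : Fin N → K) (hw : ∀ j ∈ S, w j = 0) {x : K} (hx : x ≠ 0) :
    (fromBlocks ((-x) • (1 : Matrix (Fin S.card) (Fin S.card) K))
        (vᵀ.submatrix (S.orderEmbOfFin rfl) id) (u.submatrix id (S.orderEmbOfFin rfl))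
        (u * diagonal w * vᵀ)).det =
      (-1) ^ S.card * ∑ γ : Finset (Fin N),
        x ^ (S \ γ).card * (∏ j ∈ γ \ S, w j) * minorProd u v γ := by
  let _ : Invertible ((-x) • (1 : Matrix (Fin S.card) (Fin S.card) K)) :=
    ⟨(-x)⁻¹ • 1, by simp [smul_smul, hx], by simp [smul_smul, hx]⟩
  have hinv : ⅟((-x) • (1 : Matrix (Fin S.card) (Fin S.card) K)) = (-x)⁻¹ • 1 := rfl
  have hschur : u * diagonal w * vᵀ - u.submatrix id (S.orderEmbOfFin rfl) * ((-x)⁻¹ • (1 : Matrix (Fin S.card) (Fin S.card) K)) *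
      vᵀ.submatrix (S.orderEmbOfFin rfl) id =
      u * diagonal (fun j => if j ∈ S then x⁻¹ else w j) * vᵀ := by
    rw [Matrix.mul_smul, Matrix.smul_mul, Matrix.mul_one, submatrix_mul_submatrix_transpose]
    ext a b
    rw [sub_apply, smul_apply, mul_diagonal_mul_transpose_apply, mul_diagonal_mul_transpose_apply,
      mul_diagonal_mul_transpose_apply, smul_eq_mul, mul_sum, ← sum_sub_distrib]
    refine sum_congr rfl fun j _ => ?_
    by_cases hj : j ∈ S
    · rw [if_pos hj, if_pos hj, hw j hj, inv_neg]
      ring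
    · rw [if_neg hj, if_neg hj]
      ring
  rw [det_fromBlocks₁₁, hinv, hschur, det_mul_diagonal_mul_transpose, det_smul, det_one, mul_one,
    Fintype.card_fin, neg_pow, mul_assoc, mul_sum]
  congr 1
  refine sum_congr rfl fun γ _ => ?_
  have hsplit : ∏ j ∈ γ, (if j ∈ S then x⁻¹ else w j) =
      x⁻¹ ^ (S ∩ γ).card * ∏ j ∈ γ \ S, w j := by
    rw [prod_ite, prod_const, filter_mem_eq_inter, inter_comm, filter_notMem_eq_sdiff]
  rw [hsplit, ← mul_assoc, ← mul_assoc, ← card_sdiff_add_card_inter S γ, pow_add,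
    mul_assoc (x ^ _), ← mul_pow, mul_inv_cancel₀ hx, one_pow, mul_one]

theorem det_fromBlocks_zero_eq_sum (u v : Matrix (Fin m) (Fin N) ℂ)
    (S : Finset (Fin N)) (w : Fin N → ℂ) (hw : ∀ j ∈ S, w j = 0) :
    (fromBlocks (0 : Matrix (Fin S.card) (Fin S.card) ℂ)
        (vᵀ.submatrix (S.orderEmbOfFin rfl) id) (u.submatrix id (S.orderEmbOfFin rfl))
        (u * diagonal w * vᵀ)).det =
      (-1) ^ S.card * ∑ γ : Finset (Fin N) with S ⊆ γ,
        (∏ j ∈ γ \ S, w j) * minorProd u v γ := by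
  have hcont : Continuous fun x : ℂ => (fromBlocks
      ((-x) • (1 : Matrix (Fin S.card) (Fin S.card) ℂ))
      (vᵀ.submatrix (S.orderEmbOfFin rfl) id) (u.submatrix id (S.orderEmbOfFin rfl))
      (u * diagonal w * vᵀ)).det :=
    Continuous.matrix_det (Continuous.matrix_fromBlocks (by fun_prop) (by fun_prop) (by fun_prop)
      (by fun_prop))
  have hcont' : Continuous fun x : ℂ => (-1) ^ S.card * ∑ γ : Finset (Fin N),
      x ^ (S \ γ).card * (∏ j ∈ γ \ S, w j) * minorProd u v γ := by fun_prop
  have heq := congrFun (hcont.ext_on (dense_compl_singleton (0 : ℂ)) hcont'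
    fun x hx => det_fromBlocks_neg_smul_one u v S w hw hx) 0
  simp only [neg_zero, zero_smul] at heq
  rw [heq, sum_filter]
  congr 1
  refine sum_congr rfl fun γ _ => ?_
  by_cases h : S ⊆ γ
  · rw [if_pos h, sdiff_eq_empty_iff_subset.mpr h, card_empty, pow_zero, one_mul]
  · rw [if_neg h, zero_pow, zero_mul, zero_mul]
    rwa [Ne, card_eq_zero, sdiff_eq_empty_iff_subset]

theorem image_append {α : Type*} [DecidableEq α] {a b : ℕ} (f : Fin a → α) (g : Fin b → α) :
    univ.image (Fin.append f g) = univ.image f ∪ univ.image g := by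
  ext x
  simp only [mem_image, mem_univ, true_and, mem_union]
  constructor
  · rintro ⟨i, rfl⟩
    refine Fin.addCases (fun i => ?_) (fun i => ?_) i
    · exact Or.inl ⟨i, (Fin.append_left f g i).symm⟩
    · exact Or.inr ⟨i, (Fin.append_right f g i).symm⟩
  · rintro (⟨i, rfl⟩ | ⟨i, rfl⟩)
    · exact ⟨_, Fin.append_left f g i⟩
    · exact ⟨_, Fin.append_right f g i⟩

theorem det_submatrix_append_mul (u v : Matrix (Fin m) (Fin N) R) (a S b : Finset (Fin N))
    (hab : Disjoint a b) (hSa : Disjoint S a) (hSb : Disjoint S b)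
    (H : m = a.card + S.card + b.card) :
    (u.submatrix id (Fin.append (Fin.append (a.orderEmbOfFin rfl) (S.orderEmbOfFin rfl))
        (b.orderEmbOfFin rfl) ∘ Fin.cast H)).det *
      (v.submatrix id (Fin.append (Fin.append (a.orderEmbOfFin rfl) (S.orderEmbOfFin rfl))
        (b.orderEmbOfFin rfl) ∘ Fin.cast H)).det = minorProd u v (a ∪ S ∪ b) := by
  have himage : univ.image (Fin.append (Fin.append (a.orderEmbOfFin rfl) (S.orderEmbOfFin rfl))
      (b.orderEmbOfFin rfl) ∘ Fin.cast H) = a ∪ S ∪ b := by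
    change univ.image (_ ∘ finCongr H) = _
    rw [← image_image, image_univ_equiv, image_append, image_append]
    simp only [image_orderEmbOfFin_univ]
  refine minorProd_eq_of_image_eq u v ?_ himage
  rw [← Set.injOn_univ, ← coe_univ, ← card_image_iff, himage, card_univ, Fintype.card_fin,
    card_union_of_disjoint (disjoint_union_left.mpr ⟨hab, hSb⟩), card_union_of_disjoint hSa.symm]
  exact H.symm

theorem prod_parity_weight {a b Bl Br : Finset (Fin N)} (ha : a ⊆ Bl) (hb : b ⊆ Br)
    (hBlBr : Disjoint Bl Br) :
    (∏ j ∈ a ∪ b, if j ∈ Bl ∪ Br then 1 - 2 * (if j ∈ Br then (1 : R) else 0) else 0) =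
      (-1) ^ b.card := by
  rw [prod_union (hBlBr.mono ha hb), prod_eq_one fun j hj => ?_, one_mul,
    prod_eq_pow_card fun j hj => ?_]
  · rw [if_pos (mem_union_right _ (hb hj)), if_pos (hb hj)]
    ring
  · rw [if_pos (mem_union_left _ (ha hj)), if_neg (disjoint_left.mp hBlBr (ha hj))]
    ring

theorem sum_minorProd_eq_sum_weight (u v : Matrix (Fin m) (Fin N) ℂ) (S Bl Br : Finset (Fin N))
    (hSBl : Disjoint S Bl) (hSBr : Disjoint S Br) (hBlBr : Disjoint Bl Br)
    (p : ℕ) (hp : p < 2) :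
    ∑ q ∈ (Bl.powerset ×ˢ Br.powerset).filter fun q =>
        q.1.card + q.2.card = m - S.card ∧ q.2.card % 2 = p, minorProd u v (q.1 ∪ S ∪ q.2) =
      ∑ γ : Finset (Fin N) with S ⊆ γ,
        ((∏ j ∈ γ \ S, if j ∈ Bl ∪ Br then (1 : ℂ) else 0) + (-1) ^ p *
          ∏ j ∈ γ \ S, if j ∈ Bl ∪ Br then 1 - 2 * (if j ∈ Br then (1 : ℂ) else 0) else 0) / 2 *
        minorProd u v γ := by
  have hsdiff : ∀ a ⊆ Bl, ∀ b ⊆ Br, (a ∪ S ∪ b) \ S = a ∪ b := fun a ha b hb => by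
    rw [union_right_comm, union_sdiff_cancel_right]
    exact (disjoint_union_right.mpr ⟨hSBl.mono_right ha, hSBr.mono_right hb⟩).symm
  have hone : ∀ a ⊆ Bl, ∀ b ⊆ Br,
      (∏ j ∈ a ∪ b, if j ∈ Bl ∪ Br then (1 : ℂ) else 0) = 1 := fun a ha b hb =>
    prod_eq_one fun j hj => if_pos (union_subset_union ha hb hj)
  have hinter : ∀ a ⊆ Bl, ∀ b ⊆ Br,
      (a ∪ S ∪ b) ∩ Bl = a ∧ (a ∪ S ∪ b) ∩ Br = b := fun a ha b hb => by
    have h1 : ∀ j, j ∈ S → j ∉ Bl := fun _ hj => disjoint_left.mp hSBl hj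
    have h2 : ∀ j, j ∈ S → j ∉ Br := fun _ hj => disjoint_left.mp hSBr hj
    have h3 : ∀ j, j ∈ Bl → j ∉ Br := fun _ hj => disjoint_left.mp hBlBr hj
    constructor <;> ext j <;> have := @ha j <;> have := @hb j <;> have := h1 j <;>
      have := h2 j <;> have := h3 j <;> simp only [mem_inter, mem_union] <;> tauto
  refine sum_of_injOn (fun q => q.1 ∪ S ∪ q.2) ?_ ?_ ?_ ?_
  · rintro ⟨a, b⟩ hq ⟨a', b'⟩ hq' h
    simp only [coe_filter, mem_product, mem_powerset, Set.mem_ofPred_eq] at hq hq'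
    obtain ⟨hl, hr⟩ := hinter a hq.1.1 b hq.1.2
    obtain ⟨hl', hr'⟩ := hinter a' hq'.1.1 b' hq'.1.2
    simp only at h
    rw [h] at hl hr
    exact Prod.ext (hl.symm.trans hl') (hr.symm.trans hr')
  · rintro ⟨a, b⟩ -
    simp only [coe_filter, mem_univ, true_and, Set.mem_ofPred_eq]
    exact subset_union_right.trans subset_union_left
  · intro γ hγ hnot
    have hSγ : S ⊆ γ := (mem_filter.mp hγ).2
    by_cases hcard : γ.card = m
    swap
    · rw [minorProd, dif_neg hcard, mul_zero]
    by_cases hsub : γ \ S ⊆ Bl ∪ Br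
    swap
    · obtain ⟨j, hj, hjB⟩ := not_subset.mp hsub
      rw [prod_eq_zero hj (if_neg hjB), prod_eq_zero hj (if_neg hjB)]
      ring
    have hunion : γ ∩ Bl ∪ γ ∩ Br = γ \ S := by
      rw [← inter_union_distrib_left]
      refine Subset.antisymm (fun j hj => ?_) fun j hj =>
        mem_inter.mpr ⟨(mem_sdiff.mp hj).1, hsub hj⟩
      obtain ⟨hjγ, hjB⟩ := mem_inter.mp hj
      exact mem_sdiff.mpr
        ⟨hjγ, fun hjS => disjoint_left.mp (disjoint_union_right.mpr ⟨hSBl, hSBr⟩) hjS hjB⟩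
    have hl : γ ∩ Bl ⊆ Bl := inter_subset_right
    have hr : γ ∩ Br ⊆ Br := inter_subset_right
    have hpar : (γ ∩ Br).card % 2 ≠ p := fun hpar => hnot ⟨(γ ∩ Bl, γ ∩ Br), by
      simp only [coe_filter, mem_product, mem_powerset, Set.mem_ofPred_eq]
      refine ⟨⟨hl, hr⟩, ?_, hpar⟩
      rw [← card_union_of_disjoint (hBlBr.mono hl hr), hunion, card_sdiff_of_subset hSγ, hcard], by
      simp only
      rw [union_right_comm, hunion, sdiff_union_of_subset hSγ]⟩
    rw [← hunion, hone _ hl _ hr, prod_parity_weight hl hr hBlBr, ← pow_add, Odd.neg_one_pow]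
    · ring
    · rw [Nat.odd_iff]
      omega
  · rintro ⟨a, b⟩ hq
    simp only [mem_filter, mem_product, mem_powerset] at hq
    obtain ⟨⟨ha, hb⟩, -, hpar⟩ := hq
    simp only
    rw [hsdiff a ha b hb, hone a ha b hb, prod_parity_weight ha hb hBlBr, ← pow_add,
      Even.neg_one_pow]
    · ring
    · rw [Nat.even_iff]
      omega

end Matrix

/-- fixed-parity Cauchy–Binet sum.
Sum of `det(u_{[m],(β_l,S,β_r)}) det(v_{[m],(β_l,S,β_r)})` over increasing tuples
`β_l ⊆ B_l`, `β_r ⊆ B_r` with `|β_l| + |β_r| = m − |S|` and `|β_r| ≡ p (mod 2)`,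
with columns in the concatenated order `(β_l, S, β_r)`, equals
`((−1)^{|S|}/2) [det D₁ + (−1)^p det D₂]` where `D₁, D₂` are the indicated block matrices
(with `B = B_l ∪ B_r` and `(I − 2P_{B_r})_{BB}` inserted in `D₂`). -/
theorem statement10 (m N : ℕ) (hm : 1 ≤ m) (hN : 1 ≤ N)
    (u v : Matrix (Fin m) (Fin N) ℂ) (S Bl Br : Finset (Fin N))
    (hSBl : Disjoint S Bl) (hSBr : Disjoint S Br) (hBlBr : Disjoint Bl Br)
    (hS : S.card ≤ m) (p : ℕ) (hp : p < 2) :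
    ∑ q ∈ ((Bl.powerset ×ˢ Br.powerset).filter fun q =>
        q.1.card + q.2.card = m - S.card ∧ q.2.card % 2 = p).attach,
      (u.submatrix id
          (Fin.append (Fin.append ⇑(q.1.1.orderEmbOfFin rfl) ⇑(S.orderEmbOfFin rfl))
              ⇑(q.1.2.orderEmbOfFin rfl) ∘
            Fin.cast (by
              have h := (Finset.mem_filter.mp q.2).2
              omega))).det *
      (v.submatrix id
          (Fin.append (Fin.append ⇑(q.1.1.orderEmbOfFin rfl) ⇑(S.orderEmbOfFin rfl))
              ⇑(q.1.2.orderEmbOfFin rfl) ∘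
            Fin.cast (by
              have h := (Finset.mem_filter.mp q.2).2
              omega))).det =
      ((-1 : ℂ) ^ S.card / 2) *
        ((Matrix.fromBlocks (0 : Matrix (Fin S.card) (Fin S.card) ℂ)
            (vᵀ.submatrix ⇑(S.orderEmbOfFin rfl) id)
            (u.submatrix id ⇑(S.orderEmbOfFin rfl))
            (u.submatrix id ⇑((Bl ∪ Br).orderEmbOfFin rfl) *
              vᵀ.submatrix ⇑((Bl ∪ Br).orderEmbOfFin rfl) id)).det
          + (-1 : ℂ) ^ p *
            (Matrix.fromBlocks (0 : Matrix (Fin S.card) (Fin S.card) ℂ)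
              (vᵀ.submatrix ⇑(S.orderEmbOfFin rfl) id)
              (u.submatrix id ⇑(S.orderEmbOfFin rfl))
              (u.submatrix id ⇑((Bl ∪ Br).orderEmbOfFin rfl) *
                ((1 : Matrix (Fin N) (Fin N) ℂ) -
                  (2 : ℂ) • Matrix.diagonal fun j => if j ∈ Br then 1 else 0).submatrix
                  ⇑((Bl ∪ Br).orderEmbOfFin rfl) ⇑((Bl ∪ Br).orderEmbOfFin rfl) *
                vᵀ.submatrix ⇑((Bl ∪ Br).orderEmbOfFin rfl) id)).det) := by
  have hsum : ∀ q ∈ (Bl.powerset ×ˢ Br.powerset).filter fun q =>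
      q.1.card + q.2.card = m - S.card ∧ q.2.card % 2 = p, Disjoint q.1 q.2 ∧
        Disjoint S q.1 ∧ Disjoint S q.2 := fun q hq => by
    obtain ⟨hl, hr⟩ := Finset.mem_product.mp (Finset.mem_filter.mp hq).1
    rw [Finset.mem_powerset] at hl hr
    exact ⟨hBlBr.mono hl hr, hSBl.mono_right hl, hSBr.mono_right hr⟩
  rw [Finset.sum_congr rfl fun q _ => Matrix.det_submatrix_append_mul u v q.1.1 S q.1.2
      (hsum q.1 q.2).1 (hsum q.1 q.2).2.1 (hsum q.1 q.2).2.2 _,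
    Finset.sum_attach _ fun q : Finset (Fin N) × Finset (Fin N) =>
      Matrix.minorProd u v (q.1 ∪ S ∪ q.2),
    Matrix.sum_minorProd_eq_sum_weight u v S Bl Br hSBl hSBr hBlBr p hp]
  have hdiag : (1 : Matrix (Fin N) (Fin N) ℂ) -
      (2 : ℂ) • Matrix.diagonal (fun j => if j ∈ Br then (1 : ℂ) else 0) =
      Matrix.diagonal fun j => 1 - 2 * (if j ∈ Br then (1 : ℂ) else 0) := by
    rw [← Matrix.diagonal_one, ← Matrix.diagonal_smul, Matrix.diagonal_sub]
    rfl
  have hS0 : ∀ j ∈ S, j ∉ Bl ∪ Br := fun j hj =>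
    Finset.disjoint_left.mp (Finset.disjoint_union_right.mpr ⟨hSBl, hSBr⟩) hj
  rw [hdiag, Matrix.submatrix_mul_submatrix_transpose,
    Matrix.submatrix_mul_diagonal_mul_submatrix_transpose,
    Matrix.det_fromBlocks_zero_eq_sum u v S _ fun j hj => if_neg (hS0 j hj),
    Matrix.det_fromBlocks_zero_eq_sum u v S _ fun j hj => if_neg (hS0 j hj),
    mul_left_comm, ← mul_add, ← mul_assoc, div_mul_eq_mul_div, ← mul_pow, neg_one_mul, neg_neg,
    one_pow, Finset.mul_sum, ← Finset.sum_add_distrib, Finset.mul_sum]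
  refine Finset.sum_congr rfl fun γ _ => ?_
  ring

end
end
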